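/- Let f be C¹, positive, nondecreasing on (−∞,0] and nonincreasing on [0,∞), and let ρ > 0 and η ∈ ℝ with ρ + η ≥ 0. Define h_V(x) = F⁻¹(x) + ((η+ρ)/ρ)·x/f(F⁻¹(x)). Then h_V is differentiable with h_V'(x) = (η+2ρ)/(ρ·f(F⁻¹(x))) − ((η+ρ)/ρ)·x·f'(F⁻¹(x))/f(F⁻¹(x))³ > 0 for every x ∈ ℝ, one has x·(h_V(x) − F⁻¹(x)) ≥ 0 for every x, and h_V is an increasing bijection of ℝ onto ℝ. -/

import Mathlib

open MeasureTheory Filter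

/-- `F(y) = ∫_0^y f(x) dx`. -/
noncomputable def Fint (f : ℝ → ℝ) (y : ℝ) : ℝ := ∫ x in (0:ℝ)..y, f x

/-- `h_V(x) = F⁻¹(x) + ((η+ρ)/ρ)·x/f(F⁻¹(x))`, where `Finv` plays the role of `F⁻¹`. -/
noncomputable def hVt (f Finv : ℝ → ℝ) (ρ η : ℝ) (x : ℝ) : ℝ :=
  Finv x + ((η + ρ) / ρ) * x / f (Finv x)

theorem Fint_hasDerivAt {f : ℝ → ℝ} (hf : Continuous f) (y : ℝ) :
    HasDerivAt (Fint f) (f y) y :=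
  intervalIntegral.integral_hasDerivAt_right (hf.intervalIntegrable _ _)
    (hf.stronglyMeasurableAtFilter _ _) hf.continuousAt

theorem Fint_strictMono {f : ℝ → ℝ} (hf : Continuous f) (hfpos : ∀ x, 0 < f x) :
    StrictMono (Fint f) :=
  strictMono_of_deriv_pos fun y => by
    rw [(Fint_hasDerivAt hf y).deriv]
    exact hfpos y

/-- If `f` increases before `0` and decreases after `0`, its derivative has sign opposite to
that of `Fint f`. -/
theorem Fint_mul_deriv_nonpos {f : ℝ → ℝ} (hf : Continuous f) (hfpos : ∀ x, 0 < f x)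
    (hfmono : MonotoneOn f (Set.Iic 0)) (hfanti : AntitoneOn f (Set.Ici 0)) (y : ℝ) :
    Fint f y * deriv f y ≤ 0 := by
  have h0 : Fint f 0 = 0 := by simp [Fint]
  have hF := Fint_strictMono hf hfpos
  rcases lt_trichotomy y 0 with hy | rfl | hy
  · have h1 := hF hy
    have h2 : 0 ≤ deriv f y := by
      rw [← derivWithin_of_mem_nhds (Iic_mem_nhds hy)]
      exact hfmono.derivWithin_nonneg
    exact mul_nonpos_of_nonpos_of_nonneg (by linarith) h2
  · simp [h0]
  · have h1 := hF hy
    have h2 : deriv f y ≤ 0 := by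
      rw [← derivWithin_of_mem_nhds (Ici_mem_nhds hy)]
      exact hfanti.derivWithin_nonpos
    exact mul_nonpos_of_nonneg_of_nonpos (by linarith) h2

theorem stmt17 (f Finv : ℝ → ℝ)
    (hf : ContDiff ℝ 1 f) (hfpos : ∀ x, 0 < f x)
    (hfmono : MonotoneOn f (Set.Iic 0)) (hfanti : AntitoneOn f (Set.Ici 0))
    (hFbot : Tendsto (Fint f) atBot atBot) (hFtop : Tendsto (Fint f) atTop atTop)
    (hFinv1 : ∀ y, Fint f (Finv y) = y) (hFinv2 : ∀ y, Finv (Fint f y) = y)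
    (ρ η : ℝ) (hρ : 0 < ρ) (hρη : 0 ≤ ρ + η) :
    (∀ x : ℝ,
      HasDerivAt (hVt f Finv ρ η)
        ((η + 2 * ρ) / (ρ * f (Finv x)) -
          ((η + ρ) / ρ) * x * deriv f (Finv x) / (f (Finv x)) ^ 3) x ∧
      0 < (η + 2 * ρ) / (ρ * f (Finv x)) -
        ((η + ρ) / ρ) * x * deriv f (Finv x) / (f (Finv x)) ^ 3) ∧
    (∀ x : ℝ, 0 ≤ x * (hVt f Finv ρ η x - Finv x)) ∧
    StrictMono (hVt f Finv ρ η) ∧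
    Function.Bijective (hVt f Finv ρ η) := by
  have hc := hf.continuous
  let e : ℝ ≃o ℝ :=
    (Fint_strictMono hc hfpos).orderIsoOfRightInverse (Fint f) Finv hFinv1
  have he : ⇑e.symm = Finv := rfl
  have hFinv (x : ℝ) : HasDerivAt Finv (f (Finv x))⁻¹ x :=
    HasDerivAt.of_local_left_inverse (he ▸ e.symm.continuous).continuousAt
      (Fint_hasDerivAt hc _) (hfpos _).ne' (Eventually.of_forall hFinv1)
  have hderiv (x : ℝ) : HasDerivAt (hVt f Finv ρ η)
      ((η + 2 * ρ) / (ρ * f (Finv x)) -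
        ((η + ρ) / ρ) * x * deriv f (Finv x) / (f (Finv x)) ^ 3) x := by
    have hfd : HasDerivAt f (deriv f (Finv x)) (Finv x) :=
      (hf.differentiable one_ne_zero _).hasDerivAt
    have h := (hFinv x).add
      (((hasDerivAt_id x).const_mul ((η + ρ) / ρ)).div (hfd.comp x (hFinv x)) (hfpos _).ne')
    refine h.congr_deriv ?_
    have hp := (hfpos (Finv x)).ne'
    simp only [Function.comp_apply, id]
    field_simp
    ring
  have hpos (x : ℝ) : 0 < (η + 2 * ρ) / (ρ * f (Finv x)) -
      ((η + ρ) / ρ) * x * deriv f (Finv x) / (f (Finv x)) ^ 3 := by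
    have hp := hfpos (Finv x)
    have h1 : 0 < (η + 2 * ρ) / (ρ * f (Finv x)) := div_pos (by linarith) (by positivity)
    have h2 : x * deriv f (Finv x) ≤ 0 := by
      simpa only [hFinv1] using Fint_mul_deriv_nonpos hc hfpos hfmono hfanti (Finv x)
    have h3 : ((η + ρ) / ρ) * x * deriv f (Finv x) / (f (Finv x)) ^ 3 ≤ 0 := by
      rw [mul_assoc]
      exact div_nonpos_of_nonpos_of_nonneg
        (mul_nonpos_of_nonneg_of_nonpos (div_nonneg (by linarith) hρ.le) h2) (by positivity)
    linarith
  have hsign (x : ℝ) : 0 ≤ x * (hVt f Finv ρ η x - Finv x) := by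
    have h : x * (hVt f Finv ρ η x - Finv x) = (η + ρ) / ρ * (x * x) / f (Finv x) := by
      unfold hVt
      ring
    rw [h]
    exact div_nonneg (mul_nonneg (div_nonneg (by linarith) hρ.le) (mul_self_nonneg x))
      (hfpos _).le
  have hmono : StrictMono (hVt f Finv ρ η) :=
    strictMono_of_hasDerivAt_pos hderiv hpos
  have hcont : Continuous (hVt f Finv ρ η) :=
    continuous_iff_continuousAt.2 fun x => (hderiv x).continuousAt
  have htop : Tendsto (hVt f Finv ρ η) atTop atTop :=
    tendsto_atTop_mono' atTop
      ((eventually_gt_atTop 0).mono fun x hx =>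
        sub_nonneg.1 (nonneg_of_mul_nonneg_right (hsign x) hx))
      (he ▸ e.symm.tendsto_atTop)
  have hbot : Tendsto (hVt f Finv ρ η) atBot atBot :=
    tendsto_atBot_mono' atBot
      ((eventually_lt_atBot 0).mono fun x hx => by
        have := hsign x
        change hVt f Finv ρ η x ≤ Finv x
        by_contra! hlt
        nlinarith)
      (he ▸ e.symm.tendsto_atBot)
  exact ⟨fun x => ⟨hderiv x, hpos x⟩, hsign, hmono, hmono.injective,
    hcont.surjective htop hbot⟩
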